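/- arXiv:2311.08587 — 4 statements merged into one kernel-verified Lean document; each statement's English description precedes it below -/
import Mathlib

section
/- Let n, m, l ∈ ℝ³ be unit vectors and let a, b, c ∈ ℝ. Set M₁ = cos a · 𝟙 − i·sin a · (n·σ), M₂ = cos b · 𝟙 − i·sin b · (m·σ), M₃ = cos c · 𝟙 − i·sin c · (l·σ) in M₂(ℂ). Then (1/2)·tr(M₁M₂M₃) − (1/4)·[tr(M₁)tr(M₂M₃) + tr(M₂)tr(M₃M₁) + tr(M₃)tr(M₁M₂)] + (1/4)·tr(M₁)tr(M₂)tr(M₃) = −sin a · sin b · sin c · ((n × m) · l), where n × m is the cross product in ℝ³. -/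
open Matrix Complex

noncomputable def pauli1 : Matrix (Fin 2) (Fin 2) ℂ := !![0, 1; 1, 0]
noncomputable def pauli2 : Matrix (Fin 2) (Fin 2) ℂ := !![0, -Complex.I; Complex.I, 0]
noncomputable def pauli3 : Matrix (Fin 2) (Fin 2) ℂ := !![1, 0; 0, -1]

/-- `n·σ` for a real vector `n = (n₁, n₂, n₃)`. -/
noncomputable def dotPauli (n₁ n₂ n₃ : ℝ) : Matrix (Fin 2) (Fin 2) ℂ :=
  (n₁ : ℂ) • pauli1 + (n₂ : ℂ) • pauli2 + (n₃ : ℂ) • pauli3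

/-- The entries of the holonomy `C • 1 - (i S) • (x·σ)`. -/
theorem holonomy_eq_of (C S : ℂ) (x y z : ℝ) :
    C • (1 : Matrix (Fin 2) (Fin 2) ℂ) - (Complex.I * S) • dotPauli x y z =
      !![C - Complex.I * S * z, -Complex.I * S * x - S * y;
        -Complex.I * S * x + S * y, C + Complex.I * S * z] := by
  ext i j
  fin_cases i <;> fin_cases j <;> simp [dotPauli, pauli1, pauli2, pauli3] <;>
    ring_nf <;> simp <;> ring

/-- The half-trace of three SU(2) holonomies encodes the triple product of the axes. -/
theorem half_trace_three_holonomies (n₁ n₂ n₃ m₁ m₂ m₃ l₁ l₂ l₃ a b c : ℝ)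
    (hn : n₁ ^ 2 + n₂ ^ 2 + n₃ ^ 2 = 1) (hm : m₁ ^ 2 + m₂ ^ 2 + m₃ ^ 2 = 1)
    (hl : l₁ ^ 2 + l₂ ^ 2 + l₃ ^ 2 = 1) :
    let M₁ : Matrix (Fin 2) (Fin 2) ℂ :=
      ((Real.cos a : ℂ)) • 1 - (Complex.I * (Real.sin a : ℂ)) • dotPauli n₁ n₂ n₃
    let M₂ : Matrix (Fin 2) (Fin 2) ℂ :=
      ((Real.cos b : ℂ)) • 1 - (Complex.I * (Real.sin b : ℂ)) • dotPauli m₁ m₂ m₃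
    let M₃ : Matrix (Fin 2) (Fin 2) ℂ :=
      ((Real.cos c : ℂ)) • 1 - (Complex.I * (Real.sin c : ℂ)) • dotPauli l₁ l₂ l₃
    (1 / 2 : ℂ) * Matrix.trace (M₁ * M₂ * M₃) -
        (1 / 4 : ℂ) * (Matrix.trace M₁ * Matrix.trace (M₂ * M₃) +
          Matrix.trace M₂ * Matrix.trace (M₃ * M₁) +
          Matrix.trace M₃ * Matrix.trace (M₁ * M₂)) +
        (1 / 4 : ℂ) * Matrix.trace M₁ * Matrix.trace M₂ * Matrix.trace M₃ =
      -((Real.sin a * Real.sin b * Real.sin c *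
          ((n₂ * m₃ - n₃ * m₂) * l₁ + (n₃ * m₁ - n₁ * m₃) * l₂ +
            (n₁ * m₂ - n₂ * m₁) * l₃) : ℝ) : ℂ) := by
  intro M₁ M₂ M₃
  simp only [M₁, M₂, M₃, holonomy_eq_of, Matrix.mul_fin_two, Matrix.trace_fin_two_of]
  push_cast
  ring_nf
  simp only [Complex.I_sq]
  ring
end

section
/- Let t ∈ ℂ with t ≠ 0 and t⁴ ≠ 1, and set q = t². Let m, n ∈ ℕ with n ≤ m. Then ∑_{k=0}^{n} t^{(m−n+2k+1)² − (m+1)² − (n+1)² + 1} · [m − n + 2k + 1]_q = [(m+1)·(n+1)]_q. -/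
/-- The quantum number `[x]_q = (q^x − q^{−x})/(q − q⁻¹)` for `x ∈ ℤ`. -/
noncomputable def qnum (q : ℂ) (x : ℤ) : ℂ := (q ^ x - q ^ (-x)) / (q - q⁻¹)

lemma qnum_sq {t q : ℂ} (hq : q = t ^ 2) (x : ℤ) :
    qnum q x = (t ^ (2 * x) - t ^ (-(2 * x))) / (q - q⁻¹) := by
  have h (y : ℤ) : q ^ y = t ^ (2 * y) := by rw [hq, zpow_mul]; norm_cast
  rw [qnum, h, h, mul_neg]

/-- `s_{j₁j₂} = [(2j₁+1)(2j₂+1)]_q` for `q = t²` not a root of unity issue aside: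
`∑_{k=0}^{n} t^{(m−n+2k+1)² − (m+1)² − (n+1)² + 1} [m−n+2k+1]_q = [(m+1)(n+1)]_q`. -/
theorem s_matrix_eq_qnum (t : ℂ) (ht : t ≠ 0) (ht4 : t ^ 4 ≠ 1) (q : ℂ) (hq : q = t ^ 2)
    (m n : ℕ) (hnm : n ≤ m) :
    ∑ k ∈ Finset.range (n + 1),
        t ^ (((m : ℤ) - (n : ℤ) + 2 * (k : ℤ) + 1) ^ 2 - ((m : ℤ) + 1) ^ 2 -
              ((n : ℤ) + 1) ^ 2 + 1) *
          qnum q ((m : ℤ) - (n : ℤ) + 2 * (k : ℤ) + 1) =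
      qnum q (((m : ℤ) + 1) * ((n : ℤ) + 1)) := by
  have telescope (k : ℕ) :
      t ^ (((m : ℤ) - n + 2 * k + 1) ^ 2 - ((m : ℤ) + 1) ^ 2 - ((n : ℤ) + 1) ^ 2 + 1) *
          qnum q ((m : ℤ) - n + 2 * k + 1) =
        (t ^ (((m : ℤ) - n + 2 * (k + 1 : ℕ)) ^ 2 - ((m : ℤ) + 1) ^ 2 - ((n : ℤ) + 1) ^ 2) -
          t ^ (((m : ℤ) - n + 2 * k) ^ 2 - ((m : ℤ) + 1) ^ 2 - ((n : ℤ) + 1) ^ 2)) /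
          (q - q⁻¹) := by
    rw [qnum_sq hq, mul_div_assoc', mul_sub, ← zpow_add₀ ht, ← zpow_add₀ ht]
    push_cast
    ring_nf
  rw [Finset.sum_congr rfl fun k _ => telescope k, ← Finset.sum_div,
    Finset.sum_range_sub (fun k : ℕ =>
      t ^ (((m : ℤ) - n + 2 * k) ^ 2 - ((m : ℤ) + 1) ^ 2 - ((n : ℤ) + 1) ^ 2)),
    qnum_sq hq]
  push_cast
  ring_nf
end

section
/- Let p ∈ ℕ and t ∈ ℂ with t ≠ 0, t⁴ ≠ 1 and t^{2p} = 1, and set q = t². Let m, n ∈ ℕ with n ≤ m and m ≤ p − 2. Then ∑_{k=0}^{min(n, p−2−m)} t^{(m−n+2k+1)² − (m+1)² − (n+1)² + 1} · [m − n + 2k + 1]_q = [(m+1)·(n+1)]_q. -/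
theorem zpow_mul_qnum_sq {t : ℂ} (ht : t ≠ 0) (e x : ℤ) :
    t ^ e * qnum (t ^ 2) x =
      (t ^ (e + 2 * x) - t ^ (e - 2 * x)) / (t ^ 2 - (t ^ 2)⁻¹) := by
  have h (y : ℤ) : (t ^ 2) ^ y = t ^ (2 * y) := by
    rw [zpow_mul]; norm_cast
  rw [qnum, h, h, ← mul_div_assoc, mul_sub, ← zpow_add₀ ht, ← zpow_add₀ ht, mul_neg,
    ← sub_eq_add_neg]

theorem sum_range_zpow_sq_mul_qnum {t : ℂ} (ht : t ≠ 0) (b c : ℤ) (N : ℕ) :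
    ∑ k ∈ Finset.range N, t ^ ((b + 2 * (k : ℤ) + 1) ^ 2 + c) *
        qnum (t ^ 2) (b + 2 * (k : ℤ) + 1) =
      (t ^ ((b + 2 * (N : ℤ)) ^ 2 + c - 1) - t ^ (b ^ 2 + c - 1)) /
        (t ^ 2 - (t ^ 2)⁻¹) := by
  induction N with
  | zero => simp
  | succ N ih =>
    rw [Finset.sum_range_succ, ih, zpow_mul_qnum_sq ht, ← add_div]
    push_cast
    ring_nf

/-- The truncated fusion identity at a root of unity `t^{2p} = 1`:
`∑_{k=0}^{min(n, p−2−m)} t^{(m−n+2k+1)² − (m+1)² − (n+1)² + 1} [m−n+2k+1]_q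
  = [(m+1)(n+1)]_q`. -/
theorem s_matrix_truncated_eq_qnum (p : ℕ) (t : ℂ) (ht : t ≠ 0) (ht4 : t ^ 4 ≠ 1)
    (htp : t ^ (2 * p) = 1) (q : ℂ) (hq : q = t ^ 2) (m n : ℕ) (hnm : n ≤ m)
    (hmp : m ≤ p - 2) :
    ∑ k ∈ Finset.range (min n (p - 2 - m) + 1),
        t ^ (((m : ℤ) - (n : ℤ) + 2 * (k : ℤ) + 1) ^ 2 - ((m : ℤ) + 1) ^ 2 -
              ((n : ℤ) + 1) ^ 2 + 1) *
          qnum q ((m : ℤ) - (n : ℤ) + 2 * (k : ℤ) + 1) =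
      qnum q (((m : ℤ) + 1) * ((n : ℤ) + 1)) := by
  subst hq
  have hsum := sum_range_zpow_sq_mul_qnum ht ((m : ℤ) - n)
    (1 - ((m : ℤ) + 1) ^ 2 - ((n : ℤ) + 1) ^ 2) (min n (p - 2 - m) + 1)
  have hrhs := zpow_mul_qnum_sq ht 0 (((m : ℤ) + 1) * ((n : ℤ) + 1))
  rw [zpow_zero, one_mul] at hrhs
  rw [hrhs]
  refine Eq.trans (Finset.sum_congr rfl fun k _ => ?_) (hsum.trans ?_)
  · congr 2
    ring
  congr 2
  · rcases le_total n (p - 2 - m) with h | h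
    · rw [min_eq_left h]
      congr 1
      push_cast
      ring
    · rw [min_eq_right h]
      rcases lt_or_ge p 2 with hp | hp
      · obtain rfl : m = 0 := by omega
        obtain rfl : n = 0 := by omega
        rw [show p - 2 - 0 = 0 by omega]
        norm_num
      · have hk : ((p - 2 - m + 1 : ℕ) : ℤ) = p - 1 - m := by omega
        have hper : t ^ (2 * (p : ℤ)) = 1 := by exact_mod_cast htp
        rw [hk, show ((m : ℤ) - n + 2 * (p - 1 - m)) ^ 2 +
            (1 - ((m : ℤ) + 1) ^ 2 - ((n : ℤ) + 1) ^ 2) - 1 =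
            2 * (p : ℤ) * (2 * p - 2 * (m + n + 2)) + (0 + 2 * ((m + 1) * (n + 1))) by ring,
          zpow_add₀ ht, zpow_mul, hper, one_zpow, one_mul]
  · congr 1
    ring
end

section
/- Let k ∈ ℕ with k ≥ 1 and set q = exp(2πi/(k+2)) ∈ ℂ. Then [k+1]_q ≠ 0 and [k]_q / [k+1]_q = 2·cos(2π(k+1)/(k+2)) (as complex numbers, with the right-hand side the coercion of the real number). -/
open Real

/-- At the root of unity `q = e^{2πi/(k+2)}` with `k ≥ 1`: `[k+1]_q ≠ 0` and
`[k]_q / [k+1]_q = 2 cos(2π(k+1)/(k+2))`. -/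
theorem qnum_ratio_boundary_case (k : ℕ) (hk : 1 ≤ k) (q : ℂ)
    (hq : q = Complex.exp (2 * Real.pi * Complex.I / ((k : ℂ) + 2))) :
    qnum q ((k : ℤ) + 1) ≠ 0 ∧
      qnum q (k : ℤ) / qnum q ((k : ℤ) + 1) =
        ((2 * Real.cos (2 * Real.pi * (k + 1) / (k + 2)) : ℝ) : ℂ) := by
  have hprim : IsPrimitiveRoot q (k + 2) := by
    have h := Complex.isPrimitiveRoot_exp (k + 2) (by omega)
    push_cast at h
    rwa [hq]
  have hq0 : q ≠ 0 := hq ▸ Complex.exp_ne_zero _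
  have hsq : q ^ 2 ≠ 1 := hprim.pow_ne_one_of_pos_of_lt (by omega) (by omega)
  have hden : q - q⁻¹ ≠ 0 := by
    intro h
    apply hsq
    field_simp at h
    linear_combination h
  have hpow : q ^ ((k : ℤ) + 2) = 1 := by exact_mod_cast hprim.pow_eq_one
  have hk1 : q ^ ((k : ℤ) + 1) = q⁻¹ := by
    rw [show (k : ℤ) + 1 = (k + 2) + -1 by ring, zpow_add₀ hq0, hpow, one_mul, zpow_neg_one]
  have hk0 : q ^ (k : ℤ) = (q ^ 2)⁻¹ := by
    rw [show (k : ℤ) = (k + 2) + -2 by ring, zpow_add₀ hq0, hpow, one_mul, zpow_neg]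
    norm_cast
  have h1 : qnum q ((k : ℤ) + 1) = -1 := by
    rw [qnum, zpow_neg, hk1, inv_inv, div_eq_iff hden]
    ring
  have h0 : qnum q (k : ℤ) = -(q + q⁻¹) := by
    rw [qnum, zpow_neg, hk0, inv_inv, div_eq_iff hden]
    ring
  have hcos : Real.cos (2 * Real.pi * (k + 1) / (k + 2)) = Real.cos (2 * Real.pi / (k + 2)) := by
    rw [← Real.cos_two_pi_sub (2 * Real.pi / (k + 2))]
    congr 1
    field_simp
    ring
  refine ⟨by simp [h1], ?_⟩
  rw [h1, h0, hcos, neg_div_neg_eq, div_one]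
  push_cast
  rw [Complex.two_cos, hq, ← Complex.exp_neg]
  ring_nf
end
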